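/- arXiv:2511.04558 — 2 statements merged into one kernel-verified Lean document; each statement's English description precedes it below -/
import Mathlib

section
/- Fix an integer constant ℓ ≥ 1. Draw a random sandwiched (2ℓ)-level Talagrand function f = f_{M,H} as follows: the multiplexer tree M is drawn by choosing, independently and uniformly at random, the tuple in [n]^n defining the term of each odd-level edge and the tuple in [n]^n defining the clause of each even-level edge; independently, a secret variable s is drawn uniformly from [n], and for each leaf u, independently, h_u is set to the dictatorship function h_u(x) = x_s with probability 1/2 and to the anti-dictatorship function h_u(x) = 1 − x_s with probability 1/2. Then there exist constants ε > 0 and c > 0 depending only on ℓ, and n₀ ∈ ℕ, such that for all n ≥ n₀ divisible by 4, with probability at least c over the draw of f, reldist(f, unate) ≥ ε (and hence also reldist(f, monotone) ≥ ε). -/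
open scoped Classical
open Finset

/-- Result of the sandwiched multiplexer map: a leaf (encoded as the list of child
indices from the leaf up to the root) or a special label `0*`, `1*`. -/
inductive SMuxResult : Type where
  | leaf : List ℕ → SMuxResult
  | zeroStar : SMuxResult
  | oneStar : SMuxResult

/-- The edge into node `v` (at level `v.length`) is activated by `x`: the size-`n`
term on it (odd level) is satisfied, resp. the size-`n` clause on it (even level)
is falsified. -/
def SActivated {n : ℕ} (M : List ℕ → Fin n → Fin n)
    (x : Fin n → Bool) (v : List ℕ) : Prop :=
  if v.length % 2 = 1 then ∀ k, x (M v k) = true else ∀ k, x (M v k) = false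

/-- Descend along the unique activation path: a node at even level has `N1` children
and a node at odd level has `N0` children. -/
noncomputable def SGammaAux (N1 N0 : ℕ) {n : ℕ} (M : List ℕ → Fin n → Fin n)
    (x : Fin n → Bool) : ℕ → List ℕ → SMuxResult
  | 0, u => SMuxResult.leaf u
  | fuel + 1, u =>
    if h : ∃! a : ℕ, a < (if u.length % 2 = 0 then N1 else N0) ∧
        SActivated M x (a :: u) then
      SGammaAux N1 N0 M x fuel (h.exists.choose :: u)
    else if ∀ a : ℕ, a < (if u.length % 2 = 0 then N1 else N0) →
        ¬ SActivated M x (a :: u) then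
      (if u.length % 2 = 0 then SMuxResult.zeroStar else SMuxResult.oneStar)
    else
      (if u.length % 2 = 0 then SMuxResult.oneStar else SMuxResult.zeroStar)

/-- Hamming weight. -/
def hwt {n : ℕ} (x : Fin n → Bool) : ℕ := (univ.filter fun i => x i = true).card

/-- The sandwiched `(2ℓ)`-level Talagrand function `f_{M,H}`: `0` below the sandwich
layers (`|x| < 3n/4`), `1` above them (`|x| > 3n/4 + 1`), and determined by the
multiplexer map and the leaf functions `H` within the sandwich layers. -/
noncomputable def STalagrand (ℓ N1 N0 : ℕ) {n : ℕ} (M : List ℕ → Fin n → Fin n)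
    (H : List ℕ → (Fin n → Bool) → Bool) (x : Fin n → Bool) : Bool :=
  if 4 * hwt x < 3 * n then false
  else if 3 * n + 4 < 4 * hwt x then true
  else
    match SGammaAux N1 N0 M x (2 * ℓ) [] with
    | SMuxResult.zeroStar => false
    | SMuxResult.oneStar => true
    | SMuxResult.leaf u => H u x

/-- `g` is unate: for some `a ∈ {0,1}^n`, `x ↦ g (x ⊕ a)` is monotone. -/
def Unate {n : ℕ} (g : (Fin n → Bool) → Bool) : Prop :=
  ∃ a : Fin n → Bool, Monotone fun x : Fin n → Bool => g fun i => xor (x i) (a i)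

/-- Relative distance `|f⁻¹(1) △ g⁻¹(1)| / |f⁻¹(1)|`. -/
noncomputable def relDist {n : ℕ} (f g : (Fin n → Bool) → Bool) : ℝ :=
  ((symmDiff (univ.filter fun z : Fin n → Bool => f z = true)
      (univ.filter fun z : Fin n → Bool => g z = true)).card : ℝ) /
    ((univ.filter fun z : Fin n → Bool => f z = true).card : ℝ)

/-- Convert finitely-encoded edge labels (indexed by the level of a node together
with its path from the root, padded to a function on `Fin (2ℓ)` with values reduced
mod `B+1`, where `B` bounds the child indices) into a multiplexer tree.  The encoding
is injective on the nodes of the tree, so choosing the finite data uniformly at random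
amounts to labelling every edge with an independent uniformly random tuple in
`[n]^n`. -/
def smtreeOf (ℓ B : ℕ) {n : ℕ} (hn : 0 < n)
    (M' : Fin (2 * ℓ + 1) → (Fin (2 * ℓ) → Fin (B + 1)) → Fin n → Fin n) :
    List ℕ → Fin n → Fin n :=
  fun v =>
    if hv : v.length ≤ 2 * ℓ then
      M' ⟨v.length, by omega⟩
        (fun i => ⟨v.getD i.val 0 % (B + 1), Nat.mod_lt _ (Nat.succ_pos B)⟩)
    else fun _ => ⟨0, hn⟩

/-- The random leaf functions: for each leaf (a length-`2ℓ` path, encoded injectively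
as a function on `Fin (2ℓ)`), an independent fair coin decides between the
dictatorship `x ↦ x_s` and the anti-dictatorship `x ↦ ¬ x_s` of the secret variable
`sVar`. -/
def shOf (ℓ B : ℕ) {n : ℕ} (sVar : Fin n)
    (coins : (Fin (2 * ℓ) → Fin (B + 1)) → Bool) :
    List ℕ → (Fin n → Bool) → Bool :=
  fun v x =>
    if coins (fun i => ⟨v.getD i.val 0 % (B + 1), Nat.mod_lt _ (Nat.succ_pos B)⟩)
    then x sVar else !(x sVar)

/-- The sample space for the sandwiched `D_no` distribution: independent uniform
labels for all edges, a uniform secret variable, and independent fair coins for the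
leaves.  Here `B := max N1 N0` bounds all child indices. -/
abbrev OmegaS (ℓ n B : ℕ) : Type :=
  (Fin (2 * ℓ + 1) → (Fin (2 * ℓ) → Fin (B + 1)) → Fin n → Fin n) ×
    Fin n × ((Fin (2 * ℓ) → Fin (B + 1)) → Bool)

/-- The random sandwiched `(2ℓ)`-level Talagrand function determined by a sample
point `ω`, with `N1 = ⌈(4/3)^n⌉` and `N0 = 4^n`. -/
noncomputable def sandwichFn (ℓ : ℕ) {n : ℕ} (hn : 0 < n)
    (ω : OmegaS ℓ n (max (⌈((4 : ℝ) / 3) ^ n⌉₊) (4 ^ n))) :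
    (Fin n → Bool) → Bool :=
  STalagrand ℓ (⌈((4 : ℝ) / 3) ^ n⌉₊) (4 ^ n)
    (smtreeOf ℓ (max (⌈((4 : ℝ) / 3) ^ n⌉₊) (4 ^ n)) hn ω.1)
    (shOf ℓ (max (⌈((4 : ℝ) / 3) ^ n⌉₊) (4 ^ n)) ω.2.1 ω.2.2)

open scoped BigOperators

/-- The real-valued indicator of a proposition. -/
noncomputable def ind (p : Prop) : ℝ := if p then 1 else 0

lemma ind_nonneg (p : Prop) : 0 ≤ ind p := by
  unfold ind; split_ifs <;> norm_num

lemma ind_le_one (p : Prop) : ind p ≤ 1 := by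
  unfold ind; split_ifs <;> norm_num

lemma ind_of_true {p : Prop} (h : p) : ind p = 1 := if_pos h

lemma ind_of_false {p : Prop} (h : ¬ p) : ind p = 0 := if_neg h

lemma ind_mono {p q : Prop} (h : p → q) : ind p ≤ ind q := by
  by_cases hp : p
  · rw [ind_of_true hp, ind_of_true (h hp)]
  · rw [ind_of_false hp]; exact ind_nonneg q

lemma ind_and (p q : Prop) : ind (p ∧ q) = ind p * ind q := by
  by_cases hp : p <;> by_cases hq : q <;> simp [ind, hp, hq]

lemma ind_not (p : Prop) : ind (¬ p) = 1 - ind p := by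
  by_cases hp : p <;> simp [ind, hp]

lemma ind_forall {ι : Type*} [Fintype ι] (p : ι → Prop) :
    ind (∀ i, p i) = ∏ i, ind (p i) := by
  by_cases h : ∀ i, p i
  · rw [ind_of_true h, Finset.prod_eq_one fun i _ => ind_of_true (h i)]
  · rw [ind_of_false h]
    push Not at h
    obtain ⟨i, hi⟩ := h
    exact (Finset.prod_eq_zero (mem_univ i) (ind_of_false hi)).symm

lemma sum_ind {ι : Type*} (s : Finset ι) (p : ι → Prop) [DecidablePred p] :
    ∑ i ∈ s, ind (p i) = ((s.filter p).card : ℝ) := by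
  rw [Finset.card_filter]
  push_cast
  exact Finset.sum_congr rfl fun i _ => by unfold ind; split_ifs <;> rfl

lemma expect_ind {ι : Type*} [Fintype ι] (p : ι → Prop) [DecidablePred p] :
    𝔼 i, ind (p i) = ((univ.filter p).card : ℝ) / Fintype.card ι := by
  rw [Fintype.expect_eq_sum_div_card, sum_ind]

lemma ind_exists_le_sum {ι : Type*} [Fintype ι] (p : ι → Prop) :
    ind (∃ i, p i) ≤ ∑ i, ind (p i) := by
  by_cases h : ∃ i, p i
  · obtain ⟨i, hi⟩ := h
    calc ind (∃ i, p i) ≤ 1 := ind_le_one _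
      _ = ind (p i) := (ind_of_true hi).symm
      _ ≤ ∑ i, ind (p i) := Finset.single_le_sum (f := fun i => ind (p i))
          (fun j _ => ind_nonneg _) (mem_univ i)
  · rw [ind_of_false h]
    exact Finset.sum_nonneg fun i _ => ind_nonneg _

lemma sum_ind_le_ind_exists {ι : Type*} [Fintype ι] (p : ι → Prop)
    (hp : ∀ i j, p i → p j → i = j) : ∑ i, ind (p i) ≤ ind (∃ i, p i) := by
  by_cases h : ∃ i, p i
  · rw [ind_of_true h]
    obtain ⟨i, hi⟩ := h
    rw [Finset.sum_eq_single i (fun j _ hj => ind_of_false fun h => hj (hp j i h hi))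
      (fun h => absurd (mem_univ i) h), ind_of_true hi]
  · rw [ind_of_false h]
    push Not at h
    exact (Finset.sum_eq_zero fun i _ => ind_of_false (h i)).le

/-- Coordinates of a uniform function are independent. -/
lemma expect_prod_comp_injective {ι Z L : Type*} [Fintype ι] [Fintype Z] [DecidableEq Z] [Fintype L]
    [Nonempty L] {e : ι → Z} (he : Function.Injective e) (φ : ι → L → ℝ) :
    𝔼 F : Z → L, ∏ b, φ b (F (e b)) = ∏ b, 𝔼 l, φ b l := by
  have h1 : ∀ F : Z → L, ∏ b, φ b (F (e b)) =
      ∏ z, Function.extend e φ (fun _ _ => 1) z (F z) := by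
    intro F
    refine Fintype.prod_of_injective e he _ _ ?_ ?_
    · intro z hz
      rw [Function.extend_apply' _ _ _ (by simpa using hz)]
    · intro i
      rw [he.extend_apply]
  have h2 : ∏ b, 𝔼 l, φ b l = ∏ z, 𝔼 l, Function.extend e φ (fun _ _ => 1) z l := by
    refine Fintype.prod_of_injective e he _ _ ?_ ?_
    · intro z hz
      rw [Function.extend_apply' _ _ _ (by simpa using hz)]
      simp
    · intro i
      rw [he.extend_apply]
  rw [h2]
  simp_rw [h1, Fintype.expect_eq_sum_div_card]
  rw [Finset.prod_div_distrib, Finset.prod_univ_sum, Fintype.piFinset_univ]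
  simp [Finset.prod_const]

lemma expect_eval {Z L : Type*} [Fintype Z] [DecidableEq Z] [Fintype L] [Nonempty L] (z : Z) (φ : L → ℝ) :
    𝔼 F : Z → L, φ (F z) = 𝔼 l, φ l := by
  have := expect_prod_comp_injective (ι := Unit) (e := fun _ => z)
    (fun _ _ _ => rfl) (fun _ : Unit => φ)
  simpa using this

/-- Resampling one coordinate of a uniform function does not change expectations. -/
lemma expect_expect_update {Z L : Type*} [Fintype Z] [DecidableEq Z] [Fintype L] [Nonempty L] (z : Z)
    (g : (Z → L) → ℝ) :
    𝔼 F : Z → L, 𝔼 b : L, g (Function.update F z b) = 𝔼 F : Z → L, g F := by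
  have h := Fintype.expect_equiv
    (⟨fun p => (Function.update p.1 z p.2, p.1 z), fun p => (Function.update p.1 z p.2, p.1 z),
      fun p => by simp, fun p => by simp⟩ : ((Z → L) × L) ≃ ((Z → L) × L))
    (fun p => g (Function.update p.1 z p.2)) (fun p => g p.1) (fun p => rfl)
  rw [← univ_product_univ, Finset.expect_product, Finset.expect_product] at h
  rw [h]
  simp

/-- The probability that exactly one of `N` independent labels lies in `A ⊆ D` while all
the others avoid `D`. -/
lemma exactly_one_prob {Z L : Type*} [Fintype Z] [DecidableEq Z] [Fintype L] [Nonempty L] {N : ℕ}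
    {e : Fin N → Z} (he : Function.Injective e) {A D : L → Prop} (hAD : ∀ l, A l → D l)
    {α β : ℝ} (hα : 𝔼 l, ind (A l) = α) (hβ : 𝔼 l, ind (D l) = β) :
    N * α * (1 - β) ^ N ≤
      𝔼 F : Z → L, ind (∃ a, A (F (e a)) ∧ ∀ b, b ≠ a → ¬ D (F (e b))) := by
  have hα0 : 0 ≤ α := by rw [← hα]; exact Finset.expect_nonneg fun _ _ => ind_nonneg _
  have hβ0 : 0 ≤ β := by rw [← hβ]; exact Finset.expect_nonneg fun _ _ => ind_nonneg _
  have hβ1 : β ≤ 1 := by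
    rw [← hβ]; exact Finset.expect_le univ_nonempty fun _ _ => ind_le_one _
  have key : ∀ a : Fin N, α * (1 - β) ^ N ≤
      𝔼 F : Z → L, ind (A (F (e a)) ∧ ∀ b, b ≠ a → ¬ D (F (e b))) := by
    intro a
    have h1 : ∀ F : Z → L, ind (A (F (e a)) ∧ ∀ b, b ≠ a → ¬ D (F (e b))) =
        ∏ b, (fun b l => if b = a then ind (A l) else ind (¬ D l)) b (F (e b)) := by
      intro F
      have : (A (F (e a)) ∧ ∀ b, b ≠ a → ¬ D (F (e b))) ↔
          ∀ b, if b = a then A (F (e b)) else ¬ D (F (e b)) := by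
        constructor
        · rintro ⟨h, h'⟩ b
          split_ifs with hb
          · rwa [hb]
          · exact h' b hb
        · intro h
          refine ⟨by simpa using h a, fun b hb => by simpa [hb] using h b⟩
      rw [this, ind_forall]
      refine Finset.prod_congr rfl fun b _ => ?_
      by_cases hb : b = a <;> simp [hb]
    have h2 : ∀ b : Fin N, 𝔼 l, (if b = a then ind (A l) else ind (¬ D l)) =
        if b = a then α else 1 - β := by
      intro b
      split_ifs
      · exact hα
      · simp_rw [ind_not]
        rw [Finset.expect_sub_distrib, hβ]
        simp
    rw [Finset.expect_congr rfl fun F _ => h1 F, expect_prod_comp_injective he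
      (fun b l => if b = a then ind (A l) else ind (¬ D l))]
    simp_rw [h2]
    rw [← Finset.mul_prod_erase univ _ (mem_univ a), if_pos rfl]
    refine mul_le_mul_of_nonneg_left ?_ hα0
    rw [Finset.prod_congr rfl (g := fun _ => 1 - β)
      (fun b hb => if_neg (Finset.ne_of_mem_erase hb)), Finset.prod_const]
    refine pow_le_pow_of_le_one (by linarith) (by linarith) ?_
    simp
  calc N * α * (1 - β) ^ N = ∑ _a : Fin N, α * (1 - β) ^ N := by simp; ring
    _ ≤ ∑ a : Fin N, 𝔼 F : Z → L, ind (A (F (e a)) ∧ ∀ b, b ≠ a → ¬ D (F (e b))) :=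
        Finset.sum_le_sum fun a _ => key a
    _ = 𝔼 F : Z → L, ∑ a : Fin N, ind (A (F (e a)) ∧ ∀ b, b ≠ a → ¬ D (F (e b))) :=
        (Finset.expect_sum_comm _ _ _).symm
    _ ≤ _ := by
        refine Finset.expect_le_expect fun F _ => sum_ind_le_ind_exists _ ?_
        rintro i j ⟨hi, hi'⟩ ⟨hj, hj'⟩
        by_contra hij
        exact hj' i hij (hAD _ hi)

/-- The probability that a uniform tuple has all its entries in a given set. -/
lemma expect_ind_forall {n : ℕ} (hn : 0 < n) (p : Fin n → Prop) [DecidablePred p] :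
    𝔼 T : Fin n → Fin n, ind (∀ k, p (T k)) = (((univ.filter p).card : ℝ) / n) ^ n := by
  have : Nonempty (Fin n) := ⟨⟨0, hn⟩⟩
  have h := expect_prod_comp_injective (e := id) Function.injective_id
    (fun (_ : Fin n) l => ind (p l))
  simp_rw [ind_forall]
  refine h.trans ?_
  rw [expect_ind, Finset.prod_const]
  simp

/-- The edge from `v` to its `a`-th child is the unique activated edge out of `v`, for both
`x` and `y`. -/
def JointStep (N1 N0 : ℕ) {n : ℕ} (M : List ℕ → Fin n → Fin n) (x y : Fin n → Bool)
    (v : List ℕ) (a : ℕ) : Prop :=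
  a < (if v.length % 2 = 0 then N1 else N0) ∧
    (SActivated M x (a :: v) ∧ SActivated M y (a :: v)) ∧
    ∀ b, b < (if v.length % 2 = 0 then N1 else N0) → b ≠ a →
      ¬ SActivated M x (b :: v) ∧ ¬ SActivated M y (b :: v)

/-- The node `v` lies on the unique activation paths of both `x` and `y`. -/
def JointPath (N1 N0 : ℕ) {n : ℕ} (M : List ℕ → Fin n → Fin n) (x y : Fin n → Bool) :
    List ℕ → Prop
  | [] => True
  | a :: v => JointPath N1 N0 M x y v ∧ JointStep N1 N0 M x y v a

section paths

variable {N1 N0 n : ℕ} {M : List ℕ → Fin n → Fin n} {x y : Fin n → Bool}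

lemma JointStep.symm {v : List ℕ} {a : ℕ} (h : JointStep N1 N0 M x y v a) :
    JointStep N1 N0 M y x v a :=
  ⟨h.1, h.2.1.symm, fun b hb hba => (h.2.2 b hb hba).symm⟩

lemma JointPath.symm : ∀ {v : List ℕ}, JointPath N1 N0 M x y v → JointPath N1 N0 M y x v
  | [], _ => trivial
  | _ :: _, h => ⟨h.1.symm, h.2.symm⟩

lemma JointStep.sGammaAux_succ {v : List ℕ} {a : ℕ} (h : JointStep N1 N0 M x y v a)
    (fuel : ℕ) : SGammaAux N1 N0 M x (fuel + 1) v = SGammaAux N1 N0 M x fuel (a :: v) := by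
  have hu : ∃! a : ℕ, a < (if v.length % 2 = 0 then N1 else N0) ∧
      SActivated M x (a :: v) := by
    refine ⟨a, ⟨h.1, h.2.1.1⟩, ?_⟩
    rintro b ⟨hb, hb'⟩
    by_contra hba
    exact (h.2.2 b hb hba).1 hb'
  have hc : hu.exists.choose = a := hu.unique hu.exists.choose_spec ⟨h.1, h.2.1.1⟩
  rw [SGammaAux, dif_pos hu, hc]

lemma JointPath.sGammaAux_add : ∀ {v : List ℕ}, JointPath N1 N0 M x y v → ∀ fuel : ℕ,
    SGammaAux N1 N0 M x (fuel + v.length) [] = SGammaAux N1 N0 M x fuel v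
  | [], _, _ => rfl
  | a :: v, h, fuel => by
    have := h.1.sGammaAux_add (fuel + 1)
    rw [h.2.sGammaAux_succ] at this
    rw [← this, List.length_cons]
    congr 1
    omega

lemma JointPath.sGammaAux_eq_leaf {v : List ℕ} (h : JointPath N1 N0 M x y v) :
    SGammaAux N1 N0 M x v.length [] = SMuxResult.leaf v := by
  have := h.sGammaAux_add 0
  rwa [Nat.zero_add] at this

lemma SActivated.congr {M' : List ℕ → Fin n → Fin n} {v : List ℕ} (h : M v = M' v) :
    SActivated M x v ↔ SActivated M' x v := by
  unfold SActivated
  rw [h]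

lemma JointPath.congr {M' : List ℕ → Fin n → Fin n} : ∀ {v : List ℕ},
    (∀ w : List ℕ, w.length ≤ v.length → M w = M' w) →
    JointPath N1 N0 M x y v → JointPath N1 N0 M' x y v
  | [], _, _ => trivial
  | a :: v, hM, h => by
    have hc : ∀ (b : ℕ) (z : Fin n → Bool),
        SActivated M z (b :: v) ↔ SActivated M' z (b :: v) :=
      fun b z => SActivated.congr (hM _ (by simp))
    refine ⟨h.1.congr fun w hw => hM w (by simp; omega), ?_⟩
    have h2 := h.2
    unfold JointStep at h2 ⊢
    simpa only [hc] using h2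

lemma JointPath.root_step {a : ℕ} : ∀ {v : List ℕ},
    JointPath N1 N0 M x y (v ++ [a]) → JointStep N1 N0 M x y [] a
  | [], h => h.2
  | _ :: _, h => h.1.root_step

end paths

/-- The finite code of a node of the tree. -/
def nodeCode (ℓ B : ℕ) (v : List ℕ) : Fin (2 * ℓ) → Fin (B + 1) :=
  fun i => ⟨v.getD i.val 0 % (B + 1), Nat.mod_lt _ (Nat.succ_pos B)⟩

lemma smtreeOf_of_le {ℓ B n : ℕ} (hn : 0 < n)
    (M' : Fin (2 * ℓ + 1) → (Fin (2 * ℓ) → Fin (B + 1)) → Fin n → Fin n) {v : List ℕ}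
    (hv : v.length ≤ 2 * ℓ) :
    smtreeOf ℓ B hn M' v = M' ⟨v.length, by omega⟩ (nodeCode ℓ B v) :=
  dif_pos hv

lemma nodeCode_cons_injective {ℓ B N : ℕ} (hℓ : 1 ≤ ℓ) (hN : N ≤ B) (v : List ℕ) :
    Function.Injective fun a : Fin N => nodeCode ℓ B ((a : ℕ) :: v) := by
  intro a b hab
  have h := congrArg Fin.val (congrFun hab ⟨0, by omega⟩)
  have ha := a.isLt
  have hb := b.isLt
  simp only [nodeCode, List.getD_cons_zero] at h
  rw [Nat.mod_eq_of_lt (by omega), Nat.mod_eq_of_lt (by omega)] at h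
  exact Fin.ext h

/-- The probability, over the labels of the next level, that `x ≤ y` move on together from
a given node. -/
lemma jointStep_prob {ℓ B N1 N0 n : ℕ} (hℓ : 1 ≤ ℓ) (hn : 0 < n) (hN1 : N1 ≤ B)
    (hN0 : N0 ≤ B) {x y : Fin n → Bool} (hxy : x ≤ y) {p : ℝ}
    (h1 : p ≤ N1 * (((univ.filter fun i => x i = true).card : ℝ) / n) ^ n *
      (1 - (((univ.filter fun i => y i = true).card : ℝ) / n) ^ n) ^ N1)
    (h0 : p ≤ N0 * (((univ.filter fun i => y i = false).card : ℝ) / n) ^ n *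
      (1 - (((univ.filter fun i => x i = false).card : ℝ) / n) ^ n) ^ N0)
    (M' : Fin (2 * ℓ + 1) → (Fin (2 * ℓ) → Fin (B + 1)) → Fin n → Fin n) {v : List ℕ}
    {d : ℕ} (hvd : v.length = d) (hd : d + 1 < 2 * ℓ + 1) :
    p ≤ 𝔼 F, ind (∃ a, JointStep N1 N0
      (smtreeOf ℓ B hn (Function.update M' ⟨d + 1, hd⟩ F)) x y v a) := by
  subst hvd
  have : Nonempty (Fin n) := ⟨⟨0, hn⟩⟩
  have htree : ∀ F (a : ℕ),
      smtreeOf ℓ B hn (Function.update M' ⟨v.length + 1, hd⟩ F) (a :: v) =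
        F (nodeCode ℓ B (a :: v)) := by
    intro F a
    rw [smtreeOf_of_le hn _ (by rw [List.length_cons]; omega)]
    simp only [List.length_cons, Function.update_self]
  by_cases hpar : v.length % 2 = 0
  · have hpar' : (v.length + 1) % 2 = 1 := by omega
    have hxy' : ∀ T : Fin n → Fin n, (∀ k, x (T k) = true) → ∀ k, y (T k) = true :=
      fun T h k => le_antisymm (Bool.le_true _) (h k ▸ hxy (T k))
    refine h1.trans ((exactly_one_prob (nodeCode_cons_injective hℓ hN1 v)
      (A := fun T : Fin n → Fin n => ∀ k, x (T k) = true) (D := fun T : Fin n → Fin n => ∀ k, y (T k) = true)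
      hxy' (expect_ind_forall hn fun i => x i = true)
      (expect_ind_forall hn fun i => y i = true)).trans ?_)
    refine Finset.expect_le_expect fun F _ => ind_mono ?_
    rintro ⟨a, ha, hb⟩
    refine ⟨a, ?_⟩
    unfold JointStep SActivated
    simp only [htree, List.length_cons, if_pos hpar, if_pos hpar']
    exact ⟨a.isLt, ⟨ha, hxy' _ ha⟩, fun b hbN hba =>
      have := hb ⟨b, hbN⟩ (fun h => hba (congrArg Fin.val h))
      ⟨fun h => this (hxy' _ h), this⟩⟩
  · have hpar' : ¬ (v.length + 1) % 2 = 1 := by omega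
    have hxy' : ∀ T : Fin n → Fin n, (∀ k, y (T k) = false) → ∀ k, x (T k) = false :=
      fun T h k => le_antisymm (h k ▸ hxy (T k)) (Bool.false_le _)
    refine h0.trans ((exactly_one_prob (nodeCode_cons_injective hℓ hN0 v)
      (A := fun T : Fin n → Fin n => ∀ k, y (T k) = false) (D := fun T : Fin n → Fin n => ∀ k, x (T k) = false)
      hxy' (expect_ind_forall hn fun i => y i = false)
      (expect_ind_forall hn fun i => x i = false)).trans ?_)
    refine Finset.expect_le_expect fun F _ => ind_mono ?_
    rintro ⟨a, ha, hb⟩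
    refine ⟨a, ?_⟩
    unfold JointStep SActivated
    simp only [htree, List.length_cons, if_neg hpar, if_neg hpar']
    exact ⟨a.isLt, ⟨hxy' _ ha, ha⟩, fun b hbN hba =>
      have := hb ⟨b, hbN⟩ (fun h => hba (congrArg Fin.val h))
      ⟨this, fun h => this (hxy' _ h)⟩⟩

/-- The probability that `x ≤ y` travel together down to level `d`. -/
lemma jointPath_prob {ℓ B N1 N0 n : ℕ} (hℓ : 1 ≤ ℓ) (hn : 0 < n) (hN1 : N1 ≤ B)
    (hN0 : N0 ≤ B) {x y : Fin n → Bool} (hxy : x ≤ y) {p : ℝ} (hp : 0 ≤ p)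
    (h1 : p ≤ N1 * (((univ.filter fun i => x i = true).card : ℝ) / n) ^ n *
      (1 - (((univ.filter fun i => y i = true).card : ℝ) / n) ^ n) ^ N1)
    (h0 : p ≤ N0 * (((univ.filter fun i => y i = false).card : ℝ) / n) ^ n *
      (1 - (((univ.filter fun i => x i = false).card : ℝ) / n) ^ n) ^ N0) :
    ∀ d ≤ 2 * ℓ, p ^ d ≤
      𝔼 M' : Fin (2 * ℓ + 1) → (Fin (2 * ℓ) → Fin (B + 1)) → Fin n → Fin n,
        ind (∃ v : List ℕ, v.length = d ∧
          JointPath N1 N0 (smtreeOf ℓ B hn M') x y v) := by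
  have : Nonempty (Fin n) := ⟨⟨0, hn⟩⟩
  intro d
  induction d with
  | zero =>
    intro _
    have : ∀ M' : Fin (2 * ℓ + 1) → (Fin (2 * ℓ) → Fin (B + 1)) → Fin n → Fin n,
        ind (∃ v : List ℕ, v.length = 0 ∧
          JointPath N1 N0 (smtreeOf ℓ B hn M') x y v) = 1 :=
      fun M' => ind_of_true ⟨[], rfl, trivial⟩
    simp_rw [this]
    simp
  | succ d ih =>
    intro hd
    rw [← expect_expect_update ⟨d + 1, by omega⟩]
    calc p ^ (d + 1) = p ^ d * p := pow_succ _ _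
      _ ≤ _ := mul_le_mul_of_nonneg_right (ih (by omega)) hp
      _ = _ := Finset.expect_mul _ _ _
      _ ≤ _ := Finset.expect_le_expect fun M' _ => ?_
    by_cases h : ∃ v : List ℕ, v.length = d ∧ JointPath N1 N0 (smtreeOf ℓ B hn M') x y v
    · rw [ind_of_true h, one_mul]
      obtain ⟨v, hvd, hv⟩ := h
      refine (jointStep_prob hℓ hn hN1 hN0 hxy h1 h0 M' hvd (by omega)).trans
        (Finset.expect_le_expect fun F _ => ind_mono ?_)
      rintro ⟨a, ha⟩
      refine ⟨a :: v, by simp [hvd], ?_, ha⟩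
      refine hv.congr fun w hw => ?_
      rw [smtreeOf_of_le hn _ (by omega), smtreeOf_of_le hn _ (by omega),
        Function.update_of_ne]
      intro hcon
      have := congrArg Fin.val hcon
      simp only at this
      omega
    · rw [ind_of_false h, zero_mul]
      exact Finset.expect_nonneg fun _ _ => ind_nonneg _

/-- Two inputs satisfying a common root term. -/
def RootCollision (N1 : ℕ) {n : ℕ} (M : List ℕ → Fin n → Fin n) (x y : Fin n → Bool) : Prop :=
  ∃ a : Fin N1, ∀ k, x (M [(a : ℕ)] k) = true ∧ y (M [(a : ℕ)] k) = true

lemma rootCollision_prob {ℓ B N1 n : ℕ} (hℓ : 1 ≤ ℓ) (hn : 0 < n) (x y : Fin n → Bool) :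
    𝔼 M' : Fin (2 * ℓ + 1) → (Fin (2 * ℓ) → Fin (B + 1)) → Fin n → Fin n,
        ind (RootCollision N1 (smtreeOf ℓ B hn M') x y) ≤
      N1 * (((univ.filter fun i => x i = true ∧ y i = true).card : ℝ) / n) ^ n := by
  have : Nonempty (Fin n) := ⟨⟨0, hn⟩⟩
  calc _ ≤ 𝔼 M' : Fin (2 * ℓ + 1) → (Fin (2 * ℓ) → Fin (B + 1)) → Fin n → Fin n,
        ∑ a : Fin N1, ind (∀ k, x (smtreeOf ℓ B hn M' [(a : ℕ)] k) = true ∧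
          y (smtreeOf ℓ B hn M' [(a : ℕ)] k) = true) :=
        Finset.expect_le_expect fun M' _ => ind_exists_le_sum _
    _ = ∑ a : Fin N1, 𝔼 M' : Fin (2 * ℓ + 1) → (Fin (2 * ℓ) → Fin (B + 1)) → Fin n → Fin n,
        ind (∀ k, x (smtreeOf ℓ B hn M' [(a : ℕ)] k) = true ∧
          y (smtreeOf ℓ B hn M' [(a : ℕ)] k) = true) := Finset.expect_sum_comm _ _ _
    _ = ∑ a : Fin N1,
          (((univ.filter fun i => x i = true ∧ y i = true).card : ℝ) / n) ^ n := by
        refine Finset.sum_congr rfl fun a _ => ?_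
        simp_rw [smtreeOf_of_le hn _ (show [(a : ℕ)].length ≤ 2 * ℓ by simp; omega)]
        rw [expect_eval (⟨[(a : ℕ)].length, by simp; omega⟩ : Fin (2 * ℓ + 1))
          (fun F : (Fin (2 * ℓ) → Fin (B + 1)) → Fin n → Fin n =>
            ind (∀ k, x (F (nodeCode ℓ B [(a : ℕ)]) k) = true ∧
              y (F (nodeCode ℓ B [(a : ℕ)]) k) = true)),
          expect_eval (nodeCode ℓ B [(a : ℕ)]) (fun T : Fin n → Fin n =>
            ind (∀ k, x (T k) = true ∧ y (T k) = true)),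
          expect_ind_forall hn fun i => x i = true ∧ y i = true]
    _ = _ := by simp

/-- Leaves with the same code are reached through the same root term. -/
lemma JointPath.rootCollision {ℓ B N1 N0 n : ℕ} (hℓ : 1 ≤ ℓ) (hN1 : N1 ≤ B)
    {M : List ℕ → Fin n → Fin n} {x x' y y' : Fin n → Bool} {v w : List ℕ}
    (hv : v.length = 2 * ℓ) (hw : w.length = 2 * ℓ) (hvx : JointPath N1 N0 M x x' v)
    (hwy : JointPath N1 N0 M y y' w) (h : nodeCode ℓ B v = nodeCode ℓ B w) :
    RootCollision N1 M x y := by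
  obtain ⟨v, a, rfl⟩ : ∃ v' a, v = v' ++ [a] :=
    ⟨v.dropLast, v.getLast (by intro h0; rw [h0, List.length_nil] at hv; omega),
      (List.dropLast_append_getLast _).symm⟩
  obtain ⟨w, b, rfl⟩ : ∃ w' b, w = w' ++ [b] :=
    ⟨w.dropLast, w.getLast (by intro h0; rw [h0, List.length_nil] at hw; omega),
      (List.dropLast_append_getLast _).symm⟩
  have ha := hvx.root_step
  have hb := hwy.root_step
  have ha1 : a < N1 := by simpa using ha.1
  have hb1 : b < N1 := by simpa using hb.1
  have hab : a = b := by
    have h' := congrArg Fin.val (congrFun h ⟨2 * ℓ - 1, by omega⟩)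
    have hv' : v.length = 2 * ℓ - 1 := by simp at hv; omega
    have hw' : w.length = 2 * ℓ - 1 := by simp at hw; omega
    simp only [nodeCode] at h'
    rw [List.getD_append_right _ _ _ _ (by omega), List.getD_append_right _ _ _ _ (by omega),
      hv', hw', Nat.sub_self, List.getD_cons_zero, List.getD_cons_zero,
      Nat.mod_eq_of_lt (by omega), Nat.mod_eq_of_lt (by omega)] at h'
    exact h'
  subst hab
  have hax : ∀ k, x (M [a] k) = true := by simpa [SActivated] using ha.2.1.1
  have hay : ∀ k, y (M [a] k) = true := by simpa [SActivated] using hb.2.1.1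
  exact ⟨⟨a, ha1⟩, fun k => ⟨hax k, hay k⟩⟩

lemma hwt_le {n : ℕ} (x : Fin n → Bool) : hwt x ≤ n := by
  simpa [hwt] using Finset.card_filter_le (univ : Finset (Fin n)) (fun i => x i = true)

lemma card_false_add_hwt {n : ℕ} (x : Fin n → Bool) :
    (univ.filter fun i => x i = false).card + hwt x = n := by
  have h := Finset.card_filter_add_card_filter_not (s := (univ : Finset (Fin n)))
    (fun i => x i = false)
  simpa [hwt] using h

lemma card_filter_hwt_eq (n k : ℕ) :
    (univ.filter fun x : Fin n → Bool => hwt x = k).card = n.choose k := by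
  have h : (powersetCard k (univ : Finset (Fin n))).card = n.choose k := by
    simp [card_powersetCard]
  rw [← h]
  refine Finset.card_nbij' (fun x => univ.filter fun i => x i = true)
    (fun s i => decide (i ∈ s)) ?_ ?_ ?_ ?_
  · intro x hx
    exact mem_coe.2 (mem_powersetCard.2 ⟨subset_univ _, (mem_filter.1 (mem_coe.1 hx)).2⟩)
  · intro s hs
    refine mem_coe.2 (mem_filter.2 ⟨mem_univ _, ?_⟩)
    have hs' : s.card = k := (mem_powersetCard.1 (mem_coe.1 hs)).2
    simpa [hwt] using hs'
  · intro x _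
    funext i
    simp
  · intro s _
    ext i
    simp

lemma choose_mul_two_pow_le {m : ℕ} (i : ℕ) :
    (4 * m).choose (3 * m + i) * 2 ^ i ≤ (4 * m).choose (3 * m) := by
  induction i with
  | zero => simp
  | succ i ih =>
    have h := Nat.choose_succ_right_eq (4 * m) (3 * m + i)
    refine le_trans ?_ ih
    have h2 : (4 * m).choose (3 * m + i + 1) * 2 ≤ (4 * m).choose (3 * m + i) := by
      have h3 : (4 * m).choose (3 * m + i + 1) * 2 * (3 * m + i + 1) ≤
          (4 * m).choose (3 * m + i) * (3 * m + i + 1) := by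
        calc _ = (4 * m).choose (3 * m + i) * (2 * (4 * m - (3 * m + i))) := by
              rw [mul_right_comm, h]; ring
          _ ≤ _ := Nat.mul_le_mul_left _ (by omega)
      exact Nat.le_of_mul_le_mul_right h3 (by omega)
    calc (4 * m).choose (3 * m + (i + 1)) * 2 ^ (i + 1)
        = (4 * m).choose (3 * m + i + 1) * 2 * 2 ^ i := by rw [pow_succ, ← add_assoc]; ring
      _ ≤ _ := Nat.mul_le_mul_right _ h2

/-- The number of points of weight at least `3n/4` is at most twice the size of the layer of
weight `3n/4`. -/
lemma card_filter_le_hwt (m : ℕ) :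
    ((univ.filter fun x : Fin (4 * m) → Bool => 3 * m ≤ hwt x).card : ℝ) ≤
      2 * ((4 * m).choose (3 * m) : ℝ) := by
  have h1 : (univ.filter fun x : Fin (4 * m) → Bool => 3 * m ≤ hwt x).card =
      ∑ i ∈ range (m + 1), (4 * m).choose (3 * m + i) := by
    rw [Finset.card_eq_sum_card_fiberwise (f := fun x => hwt x - 3 * m) (t := range (m + 1))]
    · refine Finset.sum_congr rfl fun i _ => ?_
      rw [← card_filter_hwt_eq, Finset.filter_filter]
      congr 1
      refine Finset.filter_congr fun x _ => ?_
      constructor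
      · rintro ⟨h, h'⟩; omega
      · intro h; constructor <;> omega
    · intro x _
      have := hwt_le x
      simp only [coe_range, Set.mem_Iio]
      omega
  rw [h1]
  push_cast
  calc ∑ i ∈ range (m + 1), ((4 * m).choose (3 * m + i) : ℝ)
      ≤ ∑ i ∈ range (m + 1), ((4 * m).choose (3 * m) : ℝ) * (1 / 2) ^ i := by
        refine Finset.sum_le_sum fun i _ => ?_
        have h : ((4 * m).choose (3 * m + i) : ℝ) * 2 ^ i ≤ (4 * m).choose (3 * m) := by
          exact_mod_cast choose_mul_two_pow_le i
        rw [one_div, inv_pow, ← div_eq_mul_inv, le_div_iff₀ (by positivity)]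
        exact h
    _ = (4 * m).choose (3 * m) * ∑ i ∈ range (m + 1), (1 / 2 : ℝ) ^ i := by
        rw [Finset.mul_sum]
    _ ≤ (4 * m).choose (3 * m) * 2 :=
        mul_le_mul_of_nonneg_left (sum_geometric_two_le _) (by positivity)
    _ = _ := mul_comm _ _

lemma choose_mul_three_pow_le (m j : ℕ) :
    (4 * m).choose j * 3 ^ j ≤ (4 * m).choose (3 * m) * 3 ^ (3 * m) := by
  have hrec : ∀ j, ((4 * m).choose (j + 1) * 3 ^ (j + 1)) * (j + 1) =
      ((4 * m).choose j * 3 ^ j) * (3 * (4 * m - j)) := by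
    intro j
    have h := Nat.choose_succ_right_eq (4 * m) j
    calc _ = ((4 * m).choose (j + 1) * (j + 1)) * 3 ^ (j + 1) := by ring
      _ = _ := by rw [h]; ring
  rcases le_total j (3 * m) with hj | hj
  · induction hj using Nat.decreasingInduction with
    | self => exact le_rfl
    | of_succ j hj ih =>
      refine le_trans ?_ ih
      refine Nat.le_of_mul_le_mul_right (c := j + 1) ?_ (by omega)
      rw [hrec]
      exact Nat.mul_le_mul_left _ (by omega)
  · induction j, hj using Nat.le_induction with
    | base => exact le_rfl
    | succ j hj ih =>
      refine le_trans ?_ ih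
      refine Nat.le_of_mul_le_mul_right (c := j + 1) ?_ (by omega)
      rw [hrec]
      exact Nat.mul_le_mul_left _ (by omega)

/-- The layer of weight `3n/4` carries a polynomial fraction of the `3/4`-biased measure. -/
lemma four_pow_le (m : ℕ) :
    4 ^ (4 * m) ≤ (4 * m + 1) * ((4 * m).choose (3 * m) * 3 ^ (3 * m)) := by
  calc 4 ^ (4 * m) = (3 + 1) ^ (4 * m) := by norm_num
    _ = ∑ j ∈ range (4 * m + 1), (4 * m).choose j * 3 ^ j := by
        rw [add_pow]
        refine Finset.sum_congr rfl fun j _ => ?_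
        simp [mul_comm]
    _ ≤ ∑ _j ∈ range (4 * m + 1), (4 * m).choose (3 * m) * 3 ^ (3 * m) :=
        Finset.sum_le_sum fun j _ => choose_mul_three_pow_le m j
    _ = _ := by simp

lemma pow_card_filter {n : ℕ} (p : Fin n → Prop) [DecidablePred p] (a : ℝ) :
    a ^ (univ.filter p).card = ∏ i, if p i then a else 1 := by
  rw [Finset.prod_ite]
  simp

lemma sum_half_pow_le {m : ℕ} (x : Fin (4 * m) → Bool) (hx : hwt x = 3 * m) :
    ∑ y ∈ univ.filter (fun y : Fin (4 * m) → Bool => hwt y = 3 * m),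
      (1 / 2 : ℝ) ^ (univ.filter fun i => x i = true ∧ y i = false).card ≤
    (7 / 6 : ℝ) ^ (3 * m) * 4 ^ m := by
  have h3 : (0 : ℝ) < 3 ^ (3 * m) := by positivity
  rw [← mul_le_mul_iff_of_pos_right h3, Finset.sum_mul]
  calc _ = ∑ y ∈ univ.filter (fun y : Fin (4 * m) → Bool => hwt y = 3 * m),
        ∏ i, (if x i = true ∧ y i = false then (1 / 2 : ℝ) else 1) *
          (if y i = true then 3 else 1) := by
        refine Finset.sum_congr rfl fun y hy => ?_
        rw [Finset.prod_mul_distrib, ← pow_card_filter, ← pow_card_filter]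
        have : (univ.filter fun i => y i = true).card = 3 * m := (mem_filter.1 hy).2
        rw [this]
    _ ≤ ∑ y : Fin (4 * m) → Bool,
        ∏ i, (if x i = true ∧ y i = false then (1 / 2 : ℝ) else 1) *
          (if y i = true then 3 else 1) := by
        refine Finset.sum_le_sum_of_subset_of_nonneg (Finset.filter_subset _ _) fun y _ _ => ?_
        refine Finset.prod_nonneg fun i _ => mul_nonneg ?_ ?_ <;> split_ifs <;> norm_num
    _ = ∏ i, ∑ b : Bool, (if x i = true ∧ b = false then (1 / 2 : ℝ) else 1) *
          (if b = true then 3 else 1) := by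
        rw [Finset.prod_univ_sum, Fintype.piFinset_univ]
    _ = ∏ i, (if x i = true then (7 / 2 : ℝ) else 1) * (if x i = false then 4 else 1) := by
        refine Finset.prod_congr rfl fun i _ => ?_
        cases x i <;> norm_num
    _ = (7 / 2 : ℝ) ^ (3 * m) * 4 ^ m := by
        rw [Finset.prod_mul_distrib, ← pow_card_filter, ← pow_card_filter]
        have h1 : (univ.filter fun i => x i = true).card = 3 * m := hx
        have h2 : (univ.filter fun i => x i = false).card = m := by
          have := card_false_add_hwt x
          omega
        rw [h1, h2]
    _ = _ := by
        rw [mul_right_comm, ← mul_pow]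
        norm_num

lemma ceil_mul_pow_le (n : ℕ) :
    (⌈((4 : ℝ) / 3) ^ n⌉₊ : ℝ) * (3 / 4) ^ n ≤ 2 := by
  have h : (⌈((4 : ℝ) / 3) ^ n⌉₊ : ℝ) ≤ (4 / 3) ^ n + 1 :=
    (Nat.ceil_lt_add_one (by positivity)).le
  calc _ ≤ (((4 : ℝ) / 3) ^ n + 1) * (3 / 4) ^ n :=
        mul_le_mul_of_nonneg_right h (by positivity)
    _ = 1 + (3 / 4) ^ n := by rw [add_mul, ← mul_pow]; norm_num
    _ ≤ 1 + 1 := by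
        have : ((3 : ℝ) / 4) ^ n ≤ 1 := pow_le_one₀ (by norm_num) (by norm_num)
        linarith
    _ = 2 := by norm_num

lemma one_le_ceil_mul_pow (n : ℕ) :
    1 ≤ (⌈((4 : ℝ) / 3) ^ n⌉₊ : ℝ) * (3 / 4) ^ n := by
  calc (1 : ℝ) = (4 / 3) ^ n * (3 / 4) ^ n := by rw [← mul_pow]; norm_num
    _ ≤ _ := mul_le_mul_of_nonneg_right (Nat.le_ceil _) (by positivity)

lemma ceil_mul_overlap_pow_le {m : ℕ} (hm : 0 < m) {x y : Fin (4 * m) → Bool}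
    (hx : hwt x = 3 * m) :
    (⌈((4 : ℝ) / 3) ^ (4 * m)⌉₊ : ℝ) *
      (((univ.filter fun i => x i = true ∧ y i = true).card : ℝ) / (4 * m : ℕ)) ^ (4 * m) ≤
    2 * (1 / 2) ^ (univ.filter fun i => x i = true ∧ y i = false).card := by
  set t := (univ.filter fun i => x i = true ∧ y i = true).card with ht
  set r := (univ.filter fun i => x i = true ∧ y i = false).card with hr
  have htr : t + r = 3 * m := by
    have h := Finset.card_filter_add_card_filter_not
      (s := (univ : Finset (Fin (4 * m))).filter fun i => x i = true) (fun i => y i = true)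
    rw [Finset.filter_filter, Finset.filter_filter] at h
    simp only [Bool.not_eq_true] at h
    rw [ht, hr]
    exact h.trans hx
  have hm' : (0 : ℝ) < m := by exact_mod_cast hm
  have htr' : (t : ℝ) = 3 * m - r := by
    have : (t : ℝ) + r = 3 * m := by exact_mod_cast htr
    linarith
  have h1 : (t : ℝ) / (4 * m : ℕ) = 3 / 4 * (t / (3 * m)) := by
    push_cast
    field_simp
  have h2 : (t : ℝ) / (3 * m) ≤ Real.exp (-(r / (3 * m))) := by
    have := Real.add_one_le_exp (-((r : ℝ) / (3 * m)))
    refine le_trans (le_of_eq ?_) this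
    rw [htr']
    field_simp
    ring
  have h3 : ((t : ℝ) / (3 * m)) ^ (4 * m) ≤ (1 / 2) ^ r := by
    calc ((t : ℝ) / (3 * m)) ^ (4 * m) ≤ Real.exp (-(r / (3 * m))) ^ (4 * m) :=
          pow_le_pow_left₀ (by positivity) h2 _
      _ = Real.exp (-(4 / 3 * r)) := by
          rw [← Real.exp_nat_mul]
          congr 1
          push_cast
          field_simp
      _ ≤ Real.exp (-1 * r) := Real.exp_le_exp.2 (by
          have : (0 : ℝ) ≤ r := by positivity
          linarith)
      _ = Real.exp (-1) ^ r := by rw [mul_comm, Real.exp_nat_mul]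
      _ ≤ (1 / 2) ^ r := by
          refine pow_le_pow_left₀ (Real.exp_pos _).le ?_ _
          rw [Real.exp_neg, one_div]
          refine inv_anti₀ (by norm_num) ?_
          have := Real.add_one_le_exp (1 : ℝ)
          linarith
  rw [h1, mul_pow, ← mul_assoc]
  exact mul_le_mul (ceil_mul_pow_le _) h3 (by positivity) (by norm_num)

/-- The expected number of pairs of points of weight `3n/4` satisfying a common root term is
negligible. -/
lemma sum_overlap_le {m : ℕ} (hm : 0 < m) :
    ∑ x ∈ univ.filter (fun y : Fin (4 * m) → Bool => hwt y = 3 * m),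
      ∑ y ∈ univ.filter (fun y : Fin (4 * m) → Bool => hwt y = 3 * m),
        (⌈((4 : ℝ) / 3) ^ (4 * m)⌉₊ : ℝ) *
          (((univ.filter fun i => x i = true ∧ y i = true).card : ℝ) / (4 * m : ℕ)) ^ (4 * m) ≤
    (2 * (4 * m + 1) * (343 / 512) ^ m) * ((4 * m).choose (3 * m) : ℝ) ^ 2 := by
  set C : ℝ := ((4 * m).choose (3 * m) : ℝ) with hC
  have hsum : (7 / 6 : ℝ) ^ (3 * m) * 4 ^ m ≤ (4 * m + 1) * (343 / 512) ^ m * C := by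
    have h : (4 : ℝ) ^ (4 * m) ≤ (4 * m + 1) * (C * 3 ^ (3 * m)) := by
      rw [hC]
      exact_mod_cast four_pow_le m
    rw [pow_mul, pow_mul] at h
    calc (7 / 6 : ℝ) ^ (3 * m) * 4 ^ m
        = (343 / (216 * 64)) ^ m * ((4 : ℝ) ^ 4) ^ m := by
          rw [pow_mul, ← mul_pow, ← mul_pow]; norm_num
      _ ≤ (343 / (216 * 64)) ^ m * ((4 * m + 1) * (C * (3 ^ 3) ^ m)) :=
          mul_le_mul_of_nonneg_left h (by positivity)
      _ = (4 * m + 1) * ((343 / (216 * 64)) ^ m * (3 ^ 3) ^ m) * C := by ring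
      _ = _ := by rw [← mul_pow]; norm_num
  calc _ ≤ ∑ x ∈ univ.filter (fun y : Fin (4 * m) → Bool => hwt y = 3 * m),
        2 * ((4 * m + 1) * (343 / 512) ^ m * C) := by
        refine Finset.sum_le_sum fun x hx => ?_
        have hx' : hwt x = 3 * m := (mem_filter.1 hx).2
        calc _ ≤ ∑ y ∈ univ.filter (fun y : Fin (4 * m) → Bool => hwt y = 3 * m),
              2 * (1 / 2 : ℝ) ^ (univ.filter fun i => x i = true ∧ y i = false).card :=
              Finset.sum_le_sum fun y _ => ceil_mul_overlap_pow_le hm hx'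
          _ ≤ _ := by
              rw [← Finset.mul_sum]
              exact mul_le_mul_of_nonneg_left ((sum_half_pow_le x hx').trans hsum) (by norm_num)
    _ = C * (2 * ((4 * m + 1) * (343 / 512) ^ m * C)) := by
        rw [Finset.sum_const, card_filter_hwt_eq, nsmul_eq_mul]
    _ = _ := by ring

lemma exp_neg_le_one_sub_pow {β : ℝ} {N : ℕ} {K : ℝ} (hβ : 0 ≤ β) (hβ' : β ≤ 1 / 2)
    (hN : N * β ≤ K) : Real.exp (-(2 * K)) ≤ (1 - β) ^ N := by
  have h1 : Real.exp (-(2 * β)) ≤ 1 - β := by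
    rw [Real.exp_neg]
    refine inv_le_of_inv_le₀ (by linarith) ?_
    have h2 : (1 - β)⁻¹ ≤ 2 * β + 1 := by
      rw [inv_le_iff_one_le_mul₀ (by linarith)]
      nlinarith
    exact h2.trans (Real.add_one_le_exp _)
  calc Real.exp (-(2 * K)) ≤ Real.exp (N * -(2 * β)) := Real.exp_le_exp.2 (by linarith)
    _ = Real.exp (-(2 * β)) ^ N := Real.exp_nat_mul _ _
    _ ≤ _ := pow_le_pow_left₀ (Real.exp_pos _).le h1 _

/-- The step probability at a term level is bounded below. -/
lemma term_step_bound {m : ℕ} (hm : 0 < m)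
    (hβ : Real.exp 2 * (3 / 4) ^ (4 * m) ≤ 1 / 2) :
    Real.exp (-(4 * Real.exp 2)) ≤ (⌈((4 : ℝ) / 3) ^ (4 * m)⌉₊ : ℝ) *
      (((3 * m : ℕ) : ℝ) / (4 * m : ℕ)) ^ (4 * m) *
      (1 - (((3 * m + 1 : ℕ) : ℝ) / (4 * m : ℕ)) ^ (4 * m)) ^ ⌈((4 : ℝ) / 3) ^ (4 * m)⌉₊ := by
  have hm' : (0 : ℝ) < m := by exact_mod_cast hm
  have h1 : ((3 * m : ℕ) : ℝ) / (4 * m : ℕ) = 3 / 4 := by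
    push_cast
    field_simp
  have h2 : (((3 * m + 1 : ℕ) : ℝ) / (4 * m : ℕ)) ^ (4 * m) ≤
      Real.exp 2 * (3 / 4) ^ (4 * m) := by
    have h3 : ((3 * m + 1 : ℕ) : ℝ) / (4 * m : ℕ) ≤ Real.exp (1 / (3 * m)) * (3 / 4) := by
      have := Real.add_one_le_exp (1 / (3 * m : ℝ))
      calc ((3 * m + 1 : ℕ) : ℝ) / (4 * m : ℕ) = (1 / (3 * m) + 1) * (3 / 4) := by
            push_cast
            field_simp
            ring
        _ ≤ _ := mul_le_mul_of_nonneg_right this (by norm_num)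
    refine (pow_le_pow_left₀ (by positivity) h3 _).trans ?_
    rw [mul_pow, ← Real.exp_nat_mul]
    refine mul_le_mul_of_nonneg_right (Real.exp_le_exp.2 ?_) (by positivity)
    push_cast
    rw [mul_one_div, div_le_iff₀ (by positivity)]
    linarith
  have h4 := exp_neg_le_one_sub_pow (N := ⌈((4 : ℝ) / 3) ^ (4 * m)⌉₊)
    (K := 2 * Real.exp 2) (by positivity) (h2.trans hβ) (by
      calc _ ≤ (⌈((4 : ℝ) / 3) ^ (4 * m)⌉₊ : ℝ) * (Real.exp 2 * (3 / 4) ^ (4 * m)) :=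
            mul_le_mul_of_nonneg_left h2 (by positivity)
        _ = (⌈((4 : ℝ) / 3) ^ (4 * m)⌉₊ : ℝ) * (3 / 4) ^ (4 * m) * Real.exp 2 := by ring
        _ ≤ 2 * Real.exp 2 :=
            mul_le_mul_of_nonneg_right (ceil_mul_pow_le _) (Real.exp_pos _).le)
  have h5 := one_le_ceil_mul_pow (4 * m)
  rw [h1]
  calc _ = 1 * Real.exp (-(2 * (2 * Real.exp 2))) := by rw [one_mul]; congr 1; ring
    _ ≤ _ := mul_le_mul h5 h4 (Real.exp_pos _).le (by positivity)

/-- The step probability at a clause level is bounded below. -/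
lemma clause_step_bound {m : ℕ} (hm : 2 ≤ m) :
    Real.exp (-10) ≤ ((4 ^ (4 * m) : ℕ) : ℝ) *
      (((m - 1 : ℕ) : ℝ) / (4 * m : ℕ)) ^ (4 * m) *
      (1 - ((m : ℝ) / (4 * m : ℕ)) ^ (4 * m)) ^ (4 ^ (4 * m)) := by
  have hm' : (2 : ℝ) ≤ m := by exact_mod_cast hm
  have h1 : (m : ℝ) / (4 * m : ℕ) = 1 / 4 := by
    push_cast
    field_simp
  have h2 : ((m - 1 : ℕ) : ℝ) / (4 * m : ℕ) = 1 / 4 * (1 - 1 / m) := by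
    rw [Nat.cast_sub (by omega)]
    push_cast
    field_simp
  have h3 : Real.exp (-8) ≤ (1 - 1 / (m : ℝ)) ^ (4 * m) := by
    have := exp_neg_le_one_sub_pow (N := 4 * m) (β := 1 / (m : ℝ)) (K := 4) (by positivity)
      (one_div_le_one_div_of_le (by norm_num) hm') (by
        push_cast
        rw [mul_one_div, div_le_iff₀ (by positivity)])
    norm_num at this
    simpa using this
  have h4 : Real.exp (-2) ≤ (1 - (1 / 4 : ℝ) ^ (4 * m)) ^ (4 ^ (4 * m)) := by
    have h5 : ((1 : ℝ) / 4) ^ (4 * m) ≤ 1 / 2 := by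
      calc ((1 : ℝ) / 4) ^ (4 * m) ≤ (1 / 4) ^ 1 :=
            pow_le_pow_of_le_one (by norm_num) (by norm_num) (by omega)
        _ ≤ _ := by norm_num
    have := exp_neg_le_one_sub_pow (N := 4 ^ (4 * m)) (K := 1) (by positivity) h5 (by
      push_cast
      rw [← mul_pow]
      norm_num)
    simpa using this
  rw [h1, h2, mul_pow, ← mul_assoc]
  have h6 : ((4 ^ (4 * m) : ℕ) : ℝ) * (1 / 4) ^ (4 * m) = 1 := by
    push_cast
    rw [← mul_pow]
    norm_num
  rw [h6, one_mul]
  calc Real.exp (-10) = Real.exp (-8) * Real.exp (-2) := by rw [← Real.exp_add]; norm_num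
    _ ≤ _ := mul_le_mul h3 h4 (Real.exp_pos _).le ((Real.exp_pos _).le.trans h3)

/-- The endpoints of the edge at `x` in direction `s` reach a common leaf. -/
def ReachTogether (ℓ N1 N0 : ℕ) {n : ℕ} (M : List ℕ → Fin n → Fin n) (s : Fin n)
    (x : Fin n → Bool) : Prop :=
  x s = false ∧
    ∃ v : List ℕ, v.length = 2 * ℓ ∧ JointPath N1 N0 M x (Function.update x s true) v

/-- The code of a leaf reached by both endpoints of the edge at `x` in direction `s`. -/
noncomputable def commonLeafCode (ℓ B N1 N0 : ℕ) {n : ℕ} (M : List ℕ → Fin n → Fin n)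
    (s : Fin n) (x : Fin n → Bool) : Fin (2 * ℓ) → Fin (B + 1) :=
  nodeCode ℓ B (Classical.epsilon fun v : List ℕ =>
    v.length = 2 * ℓ ∧ JointPath N1 N0 M x (Function.update x s true) v)

lemma ReachTogether.exists_leaf {ℓ N1 N0 n : ℕ} (B : ℕ) {M : List ℕ → Fin n → Fin n}
    {s : Fin n} {x : Fin n → Bool} (h : ReachTogether ℓ N1 N0 M s x) :
    ∃ v : List ℕ, v.length = 2 * ℓ ∧ JointPath N1 N0 M x (Function.update x s true) v ∧
      commonLeafCode ℓ B N1 N0 M s x = nodeCode ℓ B v :=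
  have hv := Classical.epsilon_spec h.2
  ⟨_, hv.1, hv.2, rfl⟩

/-- The edges in direction `s` of the sandwich layer whose endpoints reach a common leaf with
coin `b`. -/
noncomputable def edgeSet (ℓ B N1 N0 : ℕ) {m : ℕ} (M : List ℕ → Fin (4 * m) → Fin (4 * m))
    (s : Fin (4 * m)) (c : (Fin (2 * ℓ) → Fin (B + 1)) → Bool) (b : Bool) :
    Finset (Fin (4 * m) → Bool) :=
  univ.filter fun x => hwt x = 3 * m ∧ ReachTogether ℓ N1 N0 M s x ∧
    c (commonLeafCode ℓ B N1 N0 M s x) = b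

lemma hwt_update {n : ℕ} {x : Fin n → Bool} {s : Fin n} (hs : x s = false) :
    hwt (Function.update x s true) = hwt x + 1 := by
  unfold hwt
  have h : (univ.filter fun i => Function.update x s true i = true) =
      insert s (univ.filter fun i => x i = true) := by
    ext i
    by_cases hi : i = s
    · subst hi; simp
    · simp [hi]
  rw [h, Finset.card_insert_of_notMem (by simp [hs])]

lemma le_update_true {n : ℕ} (x : Fin n → Bool) (s : Fin n) :
    x ≤ Function.update x s true := by
  intro i
  by_cases hi : i = s
  · subst hi; simp [Bool.le_true]
  · simp [hi]

lemma sTalagrand_of_leaf {ℓ N1 N0 m : ℕ} {M : List ℕ → Fin (4 * m) → Fin (4 * m)}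
    {H : List ℕ → (Fin (4 * m) → Bool) → Bool} {x y : Fin (4 * m) → Bool} {v : List ℕ}
    (hv : v.length = 2 * ℓ) (h : JointPath N1 N0 M x y v) (h1 : 3 * m ≤ hwt x)
    (h2 : hwt x ≤ 3 * m + 1) : STalagrand ℓ N1 N0 M H x = H v x := by
  unfold STalagrand
  rw [if_neg (by omega), if_neg (by omega), ← hv, h.sGammaAux_eq_leaf]

lemma sTalagrand_of_mem_edgeSet {ℓ B N1 N0 m : ℕ}
    {M : List ℕ → Fin (4 * m) → Fin (4 * m)} {s : Fin (4 * m)}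
    {c : (Fin (2 * ℓ) → Fin (B + 1)) → Bool} {b : Bool} {x : Fin (4 * m) → Bool}
    (hx : x ∈ edgeSet ℓ B N1 N0 M s c b) :
    STalagrand ℓ N1 N0 M (shOf ℓ B s c) x = !b ∧
      STalagrand ℓ N1 N0 M (shOf ℓ B s c) (Function.update x s true) = b := by
  obtain ⟨hw, hT, hc⟩ := (mem_filter.1 hx).2
  obtain ⟨v, hv, hp, hcode⟩ := hT.exists_leaf B
  have hw' := hwt_update hT.1
  rw [sTalagrand_of_leaf hv hp (by omega) (by omega),
    sTalagrand_of_leaf hv hp.symm (by omega) (by omega)]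
  rw [hcode] at hc
  unfold shOf
  unfold nodeCode at hc
  simp only [hc, hT.1, Function.update_self]
  cases b <;> simp

/-- A unate function is monotone or antitone in each coordinate. -/
lemma Unate.coordinate {n : ℕ} {g : (Fin n → Bool) → Bool} (hg : Unate g) (s : Fin n) :
    (∀ x, x s = false → g x ≤ g (Function.update x s true)) ∨
      (∀ x, x s = false → g (Function.update x s true) ≤ g x) := by
  obtain ⟨a, ha⟩ := hg
  have hxor : ∀ x : Fin n → Bool,
      (fun z : Fin n → Bool => g fun i => xor (z i) (a i)) (fun i => xor (x i) (a i)) = g x := by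
    intro x
    simp
  cases has : a s
  · left
    intro x hx
    have h := ha (a := fun i => xor (x i) (a i))
      (b := fun i => xor (Function.update x s true i) (a i)) (by
        intro i
        by_cases hi : i = s
        · subst hi; simp [has, hx]
        · simp [hi])
    rwa [hxor, hxor] at h
  · right
    intro x hx
    have h := ha (a := fun i => xor (Function.update x s true i) (a i))
      (b := fun i => xor (x i) (a i)) (by
        intro i
        by_cases hi : i = s
        · subst hi; simp [has, hx]
        · simp [hi])
    rwa [hxor, hxor] at h

lemma Monotone.unate {n : ℕ} {g : (Fin n → Bool) → Bool} (hg : Monotone g) : Unate g :=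
  ⟨fun _ => false, by simpa using hg⟩

/-- Disjoint edges in direction `s` on which `f` and `g` cannot agree contribute to their
distance. -/
lemma card_le_card_symmDiff {n : ℕ} {f g : (Fin n → Bool) → Bool} {s : Fin n}
    {E : Finset (Fin n → Bool)} (hE : ∀ x ∈ E, x s = false)
    (h : ∀ x ∈ E, f x ≠ g x ∨ f (Function.update x s true) ≠ g (Function.update x s true)) :
    E.card ≤ (symmDiff (univ.filter fun z : Fin n → Bool => f z = true)
      (univ.filter fun z : Fin n → Bool => g z = true)).card := by
  have hmem : ∀ z, f z ≠ g z → z ∈ symmDiff (univ.filter fun z : Fin n → Bool => f z = true)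
      (univ.filter fun z : Fin n → Bool => g z = true) := by
    intro z hz
    rw [Finset.mem_symmDiff]
    cases hf : f z <;> cases hg : g z <;> simp_all
  refine Finset.card_le_card_of_injOn
    (fun x => if f x ≠ g x then x else Function.update x s true) ?_ ?_
  · intro x hx
    by_cases hfg : f x ≠ g x
    · simp only [if_pos hfg]; exact hmem _ hfg
    · simp only [if_neg hfg]; exact hmem _ ((h x hx).resolve_left hfg)
  · have hproj : ∀ x ∈ E, Function.update
        (if f x ≠ g x then x else Function.update x s true) s false = x := by
      intro x hx
      split_ifs <;> simp [← hE x hx]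
    intro x hx y hy hxy
    rw [← hproj x hx, ← hproj y hy]
    exact congrArg (fun z => Function.update z s false) hxy

lemma Unate.exists_card_edgeSet_le {ℓ B N1 N0 m : ℕ}
    {M : List ℕ → Fin (4 * m) → Fin (4 * m)} {s : Fin (4 * m)}
    {c : (Fin (2 * ℓ) → Fin (B + 1)) → Bool} {g : (Fin (4 * m) → Bool) → Bool}
    (hg : Unate g) : ∃ b, (edgeSet ℓ B N1 N0 M s c b).card ≤
      (symmDiff
        (univ.filter fun z => STalagrand ℓ N1 N0 M (shOf ℓ B s c) z = true)
        (univ.filter fun z => g z = true)).card := by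
  have hE : ∀ b, ∀ x ∈ edgeSet ℓ B N1 N0 M s c b, x s = false :=
    fun b x hx => (mem_filter.1 hx).2.2.1.1
  rcases hg.coordinate s with h | h
  · refine ⟨false, card_le_card_symmDiff (hE _) fun x hx => ?_⟩
    obtain ⟨h1, h2⟩ := sTalagrand_of_mem_edgeSet hx
    have h3 := h x (hE _ x hx)
    rw [h1, h2]
    by_contra! hcon
    rw [← hcon.1, ← hcon.2] at h3
    exact absurd h3 (by decide)
  · refine ⟨true, card_le_card_symmDiff (hE _) fun x hx => ?_⟩
    obtain ⟨h1, h2⟩ := sTalagrand_of_mem_edgeSet hx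
    have h3 := h x (hE _ x hx)
    rw [h1, h2]
    by_contra! hcon
    rw [← hcon.1, ← hcon.2] at h3
    exact absurd h3 (by decide)

lemma card_edgeSet_le {ℓ B N1 N0 m : ℕ} (M : List ℕ → Fin (4 * m) → Fin (4 * m))
    (s : Fin (4 * m)) (c : (Fin (2 * ℓ) → Fin (B + 1)) → Bool) (b : Bool) :
    ((edgeSet ℓ B N1 N0 M s c b).card : ℝ) ≤ ((4 * m).choose (3 * m) : ℝ) := by
  rw [← card_filter_hwt_eq]
  have h : edgeSet ℓ B N1 N0 M s c b ⊆ univ.filter fun x => hwt x = 3 * m :=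
    fun x hx => mem_filter.2 ⟨mem_univ _, (mem_filter.1 hx).2.1⟩
  exact_mod_cast Finset.card_le_card h

/-- Many edges of both signs force a large relative distance from unateness. -/
lemma Unate.le_relDist {ℓ B N1 N0 m : ℕ}
    {M : List ℕ → Fin (4 * m) → Fin (4 * m)} {s : Fin (4 * m)}
    {c : (Fin (2 * ℓ) → Fin (B + 1)) → Bool} {g : (Fin (4 * m) → Bool) → Bool}
    (hg : Unate g) {ε : ℝ} (hε : 0 < ε)
    (h : 2 * ε * ((4 * m).choose (3 * m) : ℝ) ^ 2 ≤
      (edgeSet ℓ B N1 N0 M s c true).card * (edgeSet ℓ B N1 N0 M s c false).card) :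
    ε ≤ relDist (STalagrand ℓ N1 N0 M (shOf ℓ B s c)) g := by
  set f := STalagrand ℓ N1 N0 M (shOf ℓ B s c) with hf
  set C : ℝ := ((4 * m).choose (3 * m) : ℝ) with hC
  have hCpos : 0 < C := by
    have : 0 < (4 * m).choose (3 * m) := Nat.choose_pos (by omega)
    rw [hC]
    exact_mod_cast this
  have ht := card_edgeSet_le (N1 := N1) (N0 := N0) M s c true
  have hfl := card_edgeSet_le (N1 := N1) (N0 := N0) M s c false
  have hb : ∀ b, 2 * ε * C ≤ ((edgeSet ℓ B N1 N0 M s c b).card : ℝ) := by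
    intro b
    refine le_of_mul_le_mul_right (a := C) ?_ hCpos
    calc 2 * ε * C * C = 2 * ε * C ^ 2 := by ring
      _ ≤ _ := h
      _ ≤ _ := by
        cases b
        · rw [mul_comm]
          exact mul_le_mul_of_nonneg_left ht (by positivity)
        · exact mul_le_mul_of_nonneg_left hfl (by positivity)
  have hone : 0 < ((univ.filter fun z => f z = true).card : ℝ) := by
    have h0 : 0 < ((edgeSet ℓ B N1 N0 M s c false).card : ℝ) :=
      lt_of_lt_of_le (by positivity) (hb false)
    have h1 : (edgeSet ℓ B N1 N0 M s c false).card ≤ (univ.filter fun z => f z = true).card :=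
      Finset.card_le_card fun x hx =>
        mem_filter.2 ⟨mem_univ _, by simpa using (sTalagrand_of_mem_edgeSet hx).1⟩
    exact h0.trans_le (by exact_mod_cast h1)
  have hle : ((univ.filter fun z => f z = true).card : ℝ) ≤ 2 * C := by
    refine le_trans ?_ (card_filter_le_hwt m)
    have : (univ.filter fun z => f z = true).card ≤
        (univ.filter fun x : Fin (4 * m) → Bool => 3 * m ≤ hwt x).card := by
      refine Finset.card_le_card fun x hx => mem_filter.2 ⟨mem_univ _, ?_⟩
      by_contra hcon
      have h1 := (mem_filter.1 hx).2
      rw [hf, STalagrand, if_pos (by omega)] at h1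
      exact absurd h1 (by decide)
    exact_mod_cast this
  obtain ⟨b, hcard⟩ := hg.exists_card_edgeSet_le (ℓ := ℓ) (B := B) (N1 := N1) (N0 := N0)
    (M := M) (s := s) (c := c)
  unfold relDist
  rw [le_div_iff₀ hone]
  calc ε * _ ≤ ε * (2 * C) := mul_le_mul_of_nonneg_left hle hε.le
    _ = 2 * ε * C := by ring
    _ ≤ _ := hb b
    _ ≤ _ := by exact_mod_cast hcard

lemma coins_prob {Z : Type*} [Fintype Z] [DecidableEq Z] {z z' : Z} (h : z ≠ z') :
    𝔼 c : Z → Bool, ind (c z = true) * ind (c z' = false) = 1 / 4 := by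
  have he : Function.Injective fun b : Bool => if b = true then z else z' := by
    intro b b'
    cases b <;> cases b' <;> simp [h, h.symm]
  have h1 := expect_prod_comp_injective he fun b l => ind (l = b)
  simp only [Fintype.prod_bool, if_true, Bool.false_eq_true, if_false] at h1
  rw [h1, Fintype.expect_eq_sum_div_card, Fintype.expect_eq_sum_div_card]
  norm_num [ind]

/-- For a fixed tree, the expected product of the numbers of edges of the two signs. -/
lemma expect_coins_card_mul_card {ℓ B N1 N0 m : ℕ} (hℓ : 1 ≤ ℓ) (hN1 : N1 ≤ B)
    (M : List ℕ → Fin (4 * m) → Fin (4 * m)) (s : Fin (4 * m)) (μ : ℝ) :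
    1 / 4 * (2 * μ * ∑ x ∈ univ.filter (fun x : Fin (4 * m) → Bool => hwt x = 3 * m),
        ind (ReachTogether ℓ N1 N0 M s x) - μ ^ 2 -
      ∑ x ∈ univ.filter (fun x : Fin (4 * m) → Bool => hwt x = 3 * m),
        ∑ y ∈ univ.filter (fun x : Fin (4 * m) → Bool => hwt x = 3 * m),
          ind (RootCollision N1 M x y)) ≤
    𝔼 c : (Fin (2 * ℓ) → Fin (B + 1)) → Bool,
      ((edgeSet ℓ B N1 N0 M s c true).card * (edgeSet ℓ B N1 N0 M s c false).card : ℝ) := by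
  set S := univ.filter (fun x : Fin (4 * m) → Bool => hwt x = 3 * m) with hS
  have hcard : ∀ (c : (Fin (2 * ℓ) → Fin (B + 1)) → Bool) (b : Bool),
      ((edgeSet ℓ B N1 N0 M s c b).card : ℝ) = ∑ x ∈ S,
        ind (ReachTogether ℓ N1 N0 M s x) *
          ind (c (commonLeafCode ℓ B N1 N0 M s x) = b) := by
    intro c b
    simp_rw [← ind_and]
    rw [sum_ind, hS, Finset.filter_filter, edgeSet]
  have hpair : ∀ x y, 1 / 4 * (ind (ReachTogether ℓ N1 N0 M s x) *
        ind (ReachTogether ℓ N1 N0 M s y) - ind (RootCollision N1 M x y)) ≤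
      𝔼 c : (Fin (2 * ℓ) → Fin (B + 1)) → Bool,
        (ind (ReachTogether ℓ N1 N0 M s x) *
          ind (c (commonLeafCode ℓ B N1 N0 M s x) = true)) *
        (ind (ReachTogether ℓ N1 N0 M s y) *
          ind (c (commonLeafCode ℓ B N1 N0 M s y) = false)) := by
    intro x y
    have hnn : 0 ≤ 𝔼 c : (Fin (2 * ℓ) → Fin (B + 1)) → Bool,
        (ind (ReachTogether ℓ N1 N0 M s x) *
          ind (c (commonLeafCode ℓ B N1 N0 M s x) = true)) *
        (ind (ReachTogether ℓ N1 N0 M s y) *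
          ind (c (commonLeafCode ℓ B N1 N0 M s y) = false)) :=
      Finset.expect_nonneg fun c _ => mul_nonneg (mul_nonneg (ind_nonneg _) (ind_nonneg _))
        (mul_nonneg (ind_nonneg _) (ind_nonneg _))
    have hc0 := ind_nonneg (RootCollision N1 M x y)
    by_cases hx : ReachTogether ℓ N1 N0 M s x
    swap
    · rw [ind_of_false hx] at hnn ⊢
      linarith
    by_cases hy : ReachTogether ℓ N1 N0 M s y
    swap
    · rw [ind_of_false hy] at hnn ⊢
      linarith
    by_cases hz : commonLeafCode ℓ B N1 N0 M s x = commonLeafCode ℓ B N1 N0 M s y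
    · obtain ⟨v, hv, hpv, hcv⟩ := hx.exists_leaf B
      obtain ⟨w, hw, hpw, hcw⟩ := hy.exists_leaf B
      have hcol : RootCollision N1 M x y :=
        hpv.rootCollision hℓ hN1 hv hw hpw (by rw [← hcv, ← hcw, hz])
      rw [ind_of_true hx, ind_of_true hy] at hnn ⊢
      rw [ind_of_true hcol]
      linarith
    · rw [ind_of_true hx, ind_of_true hy]
      simp only [one_mul]
      rw [coins_prob hz]
      linarith
  have hsq : 2 * μ * ∑ x ∈ S, ind (ReachTogether ℓ N1 N0 M s x) - μ ^ 2 ≤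
      ∑ x ∈ S, ∑ y ∈ S, ind (ReachTogether ℓ N1 N0 M s x) *
        ind (ReachTogether ℓ N1 N0 M s y) := by
    rw [← Finset.sum_mul_sum]
    nlinarith [sq_nonneg (∑ x ∈ S, ind (ReachTogether ℓ N1 N0 M s x) - μ)]
  simp_rw [hcard, Finset.sum_mul_sum]
  rw [Finset.expect_sum_comm]
  calc _ ≤ 1 / 4 * (∑ x ∈ S, ∑ y ∈ S, ind (ReachTogether ℓ N1 N0 M s x) *
          ind (ReachTogether ℓ N1 N0 M s y) -
        ∑ x ∈ S, ∑ y ∈ S, ind (RootCollision N1 M x y)) :=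
        mul_le_mul_of_nonneg_left (by linarith) (by norm_num)
    _ = ∑ x ∈ S, ∑ y ∈ S, 1 / 4 * (ind (ReachTogether ℓ N1 N0 M s x) *
        ind (ReachTogether ℓ N1 N0 M s y) - ind (RootCollision N1 M x y)) := by
        simp_rw [← Finset.sum_sub_distrib, Finset.mul_sum]
    _ ≤ _ := by
        refine Finset.sum_le_sum fun x _ => ?_
        rw [Finset.expect_sum_comm]
        exact Finset.sum_le_sum fun y _ => hpair x y

/-- The expected product of the numbers of edges of the two signs. -/
lemma expect_card_mul_card {ℓ B N1 N0 m : ℕ} (hℓ : 1 ≤ ℓ) (hm : 0 < m) (hn : 0 < 4 * m)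
    (hN1 : N1 ≤ B) {q δ : ℝ} (hq : 0 ≤ q)
    (hreach : ∀ (x : Fin (4 * m) → Bool) (s : Fin (4 * m)), hwt x = 3 * m → x s = false →
      q ≤ 𝔼 M' : Fin (2 * ℓ + 1) → (Fin (2 * ℓ) → Fin (B + 1)) → Fin (4 * m) → Fin (4 * m),
        ind (ReachTogether ℓ N1 N0 (smtreeOf ℓ B hn M') s x))
    (hcol : ∑ x ∈ univ.filter (fun y : Fin (4 * m) → Bool => hwt y = 3 * m),
      ∑ y ∈ univ.filter (fun y : Fin (4 * m) → Bool => hwt y = 3 * m),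
        (N1 : ℝ) *
          (((univ.filter fun i => x i = true ∧ y i = true).card : ℝ) / (4 * m : ℕ)) ^ (4 * m) ≤
      δ * ((4 * m).choose (3 * m) : ℝ) ^ 2) :
    1 / 4 * (q ^ 2 / 16 - δ) * ((4 * m).choose (3 * m) : ℝ) ^ 2 ≤
    𝔼 ω : OmegaS ℓ (4 * m) B,
      ((edgeSet ℓ B N1 N0 (smtreeOf ℓ B hn ω.1) ω.2.1 ω.2.2 true).card *
        (edgeSet ℓ B N1 N0 (smtreeOf ℓ B hn ω.1) ω.2.1 ω.2.2 false).card : ℝ) := by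
  have : Nonempty (Fin (4 * m)) := ⟨⟨0, hn⟩⟩
  set C : ℝ := ((4 * m).choose (3 * m) : ℝ) with hC
  set S := univ.filter (fun x : Fin (4 * m) → Bool => hwt x = 3 * m) with hS
  set μ : ℝ := q / 4 * C with hμ
  have hm' : (0 : ℝ) < m := by exact_mod_cast hm
  have hSC : (S.card : ℝ) = C := by rw [hS, hC, card_filter_hwt_eq]
  have hμ0 : 0 ≤ μ := by positivity
  have hmean : μ ≤ ∑ x ∈ S, 𝔼 s, 𝔼 M' : Fin (2 * ℓ + 1) →
      (Fin (2 * ℓ) → Fin (B + 1)) → Fin (4 * m) → Fin (4 * m),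
        ind (ReachTogether ℓ N1 N0 (smtreeOf ℓ B hn M') s x) := by
    calc μ = ∑ x ∈ S, q / 4 := by rw [Finset.sum_const, nsmul_eq_mul, hSC, hμ]; ring
      _ ≤ _ := by
        refine Finset.sum_le_sum fun x hx => ?_
        have hx' : hwt x = 3 * m := (mem_filter.1 hx).2
        have hquarter : 𝔼 s : Fin (4 * m), ind (x s = false) = 1 / 4 := by
          rw [expect_ind]
          have h1 : (univ.filter fun s => x s = false).card = m := by
            have := card_false_add_hwt x
            omega
          rw [h1, Fintype.card_fin]
          push_cast
          field_simp
        calc q / 4 = 𝔼 s : Fin (4 * m), ind (x s = false) * q := by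
              rw [← Finset.expect_mul, hquarter]; ring
          _ ≤ _ := by
            refine Finset.expect_le_expect fun s _ => ?_
            by_cases hs : x s = false
            · rw [ind_of_true hs, one_mul]
              exact hreach x s hx' hs
            · rw [ind_of_false hs, zero_mul]
              exact Finset.expect_nonneg fun _ _ => ind_nonneg _
  have hcol' : ∑ x ∈ S, ∑ y ∈ S, 𝔼 M' : Fin (2 * ℓ + 1) →
      (Fin (2 * ℓ) → Fin (B + 1)) → Fin (4 * m) → Fin (4 * m),
        ind (RootCollision N1 (smtreeOf ℓ B hn M') x y) ≤ δ * C ^ 2 :=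
    (Finset.sum_le_sum fun x _ => Finset.sum_le_sum fun y _ =>
      rootCollision_prob hℓ hn x y).trans hcol
  rw [← univ_product_univ, Finset.expect_product]
  simp_rw [← univ_product_univ, Finset.expect_product]
  calc 1 / 4 * (q ^ 2 / 16 - δ) * C ^ 2
      = 1 / 4 * (2 * μ * μ - μ ^ 2 - δ * C ^ 2) := by rw [hμ]; ring
    _ ≤ 1 / 4 * (2 * μ * (∑ x ∈ S, 𝔼 s, 𝔼 M' : Fin (2 * ℓ + 1) →
          (Fin (2 * ℓ) → Fin (B + 1)) → Fin (4 * m) → Fin (4 * m),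
          ind (ReachTogether ℓ N1 N0 (smtreeOf ℓ B hn M') s x)) - μ ^ 2 -
        ∑ x ∈ S, ∑ y ∈ S, 𝔼 M' : Fin (2 * ℓ + 1) →
          (Fin (2 * ℓ) → Fin (B + 1)) → Fin (4 * m) → Fin (4 * m),
          ind (RootCollision N1 (smtreeOf ℓ B hn M') x y)) := by
        have := mul_le_mul_of_nonneg_left hmean (show 0 ≤ 2 * μ by linarith)
        linarith
    _ = 𝔼 M' : Fin (2 * ℓ + 1) → (Fin (2 * ℓ) → Fin (B + 1)) → Fin (4 * m) → Fin (4 * m),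
        𝔼 s : Fin (4 * m), 1 / 4 * (2 * μ * ∑ x ∈ S,
          ind (ReachTogether ℓ N1 N0 (smtreeOf ℓ B hn M') s x) - μ ^ 2 -
          ∑ x ∈ S, ∑ y ∈ S, ind (RootCollision N1 (smtreeOf ℓ B hn M') x y)) := by
        simp_rw [← Finset.mul_expect, Finset.expect_sub_distrib, ← Finset.mul_expect,
          Finset.expect_sum_comm, Fintype.expect_const]
        congr 4
        exact Finset.sum_congr rfl fun x _ => Finset.expect_comm _ _ _
    _ ≤ _ := Finset.expect_le_expect fun M' _ => Finset.expect_le_expect fun s _ =>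
        expect_coins_card_mul_card hℓ hN1 _ s μ

/-- A bounded quantity with a large mean is often large. -/
lemma le_expect_ind_of_le_expect {Ω : Type*} [Fintype Ω] [Nonempty Ω] {X : Ω → ℝ} {K c : ℝ}
    (hK : 0 < K) (hc : 0 ≤ c) (hX : ∀ ω, X ω ≤ K) (h : 2 * c * K ≤ 𝔼 ω, X ω) :
    c ≤ 𝔼 ω, ind (c * K ≤ X ω) := by
  have h1 : 𝔼 ω, X ω ≤ 𝔼 ω, (ind (c * K ≤ X ω) * K + c * K) := by
    refine Finset.expect_le_expect fun ω _ => ?_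
    by_cases hω : c * K ≤ X ω
    · rw [ind_of_true hω]
      nlinarith [hX ω]
    · rw [ind_of_false hω]
      linarith
  rw [Finset.expect_add_distrib, Fintype.expect_const, ← Finset.expect_mul] at h1
  refine le_of_mul_le_mul_right (a := K) ?_ hK
  linarith

open Filter Topology in
lemma eventually_large_enough {κ : ℝ} (hκ : 0 < κ) : ∀ᶠ m : ℕ in atTop,
    2 ≤ m ∧ Real.exp 2 * (3 / 4) ^ (4 * m) ≤ 1 / 2 ∧
      2 * (4 * m + 1) * (343 / 512 : ℝ) ^ m ≤ κ := by
  have h1 : Tendsto (fun m : ℕ => Real.exp 2 * ((3 / 4 : ℝ) ^ 4) ^ m) atTop (𝓝 0) := by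
    simpa using (tendsto_pow_atTop_nhds_zero_of_lt_one (r := (3 / 4 : ℝ) ^ 4)
      (by norm_num) (by norm_num)).const_mul (Real.exp 2)
  have h2 : Tendsto (fun m : ℕ => 8 * ((m : ℝ) * (343 / 512 : ℝ) ^ m) +
      2 * (343 / 512 : ℝ) ^ m) atTop (𝓝 0) := by
    simpa using ((tendsto_self_mul_const_pow_of_lt_one (r := (343 / 512 : ℝ))
      (by norm_num) (by norm_num)).const_mul 8).add
      ((tendsto_pow_atTop_nhds_zero_of_lt_one (r := (343 / 512 : ℝ))
        (by norm_num) (by norm_num)).const_mul 2)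
  filter_upwards [eventually_ge_atTop 2,
    h1.eventually_le_const (show (0 : ℝ) < 1 / 2 by norm_num),
    h2.eventually_le_const hκ] with m hm hm1 hm2
  refine ⟨hm, by rwa [pow_mul], le_trans (le_of_eq ?_) hm2⟩
  ring

/-- for the random sandwiched `(2ℓ)`-level Talagrand function drawn as
in `D_no`, there are constants `ε, c > 0` (depending only on `ℓ`) such that for all
large `n` divisible by `4`, with probability at least `c` the function is `ε`-far in
relative distance from every unate function (hence from every monotone function). -/
theorem stmt18 (ℓ : ℕ) (hℓ : 1 ≤ ℓ) :
    ∃ ε : ℝ, 0 < ε ∧ ∃ c : ℝ, 0 < c ∧ ∃ n₀ : ℕ, ∀ n : ℕ, n₀ ≤ n → 4 ∣ n →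
    ∀ hn : 0 < n,
      c ≤ ((Finset.univ.filter (fun ω : OmegaS ℓ n (max (⌈((4 : ℝ) / 3) ^ n⌉₊) (4 ^ n)) =>
            (∀ g : (Fin n → Bool) → Bool, Unate g → ε ≤ relDist (sandwichFn ℓ hn ω) g) ∧
            (∀ g : (Fin n → Bool) → Bool, Monotone g →
              ε ≤ relDist (sandwichFn ℓ hn ω) g))).card : ℝ) /
          (Fintype.card (OmegaS ℓ n (max (⌈((4 : ℝ) / 3) ^ n⌉₊) (4 ^ n))) : ℝ) := by
  set p : ℝ := Real.exp (-(4 * Real.exp 2) - 10) with hp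
  have hp0 : 0 < p := Real.exp_pos _
  set q : ℝ := p ^ (2 * ℓ) with hq
  have hq0 : 0 < q := by positivity
  obtain ⟨m₀, hm₀⟩ := Filter.eventually_atTop.1
    (eventually_large_enough (κ := q ^ 2 / 32) (by positivity))
  refine ⟨q ^ 2 / 512, by positivity, q ^ 2 / 256, by positivity, 4 * m₀, ?_⟩
  rintro n hn₀ ⟨m, rfl⟩ hn
  obtain ⟨hm2, hβ, hδ⟩ := hm₀ m (by omega)
  have hm : 0 < m := by omega
  have : Nonempty (Fin (4 * m)) := ⟨⟨0, hn⟩⟩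
  set N1 := ⌈((4 : ℝ) / 3) ^ (4 * m)⌉₊ with hN1
  set B := max N1 (4 ^ (4 * m)) with hB
  have hreach : ∀ (x : Fin (4 * m) → Bool) (s : Fin (4 * m)), hwt x = 3 * m → x s = false →
      q ≤ 𝔼 M' : Fin (2 * ℓ + 1) → (Fin (2 * ℓ) → Fin (B + 1)) → Fin (4 * m) → Fin (4 * m),
        ind (ReachTogether ℓ N1 (4 ^ (4 * m)) (smtreeOf ℓ B hn M') s x) := by
    intro x s hx hs
    have hx1 : (univ.filter fun i => x i = true).card = 3 * m := hx
    have hy1 : (univ.filter fun i => Function.update x s true i = true).card = 3 * m + 1 := by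
      rw [← hx]
      exact hwt_update hs
    have hx0 : (univ.filter fun i => x i = false).card = m := by
      have := card_false_add_hwt x
      omega
    have hy0 : (univ.filter fun i => Function.update x s true i = false).card = m - 1 := by
      have := card_false_add_hwt (Function.update x s true)
      rw [hwt_update hs] at this
      omega
    refine (jointPath_prob hℓ hn (le_max_left _ _) (le_max_right _ _) (le_update_true x s)
      hp0.le ?_ ?_ (2 * ℓ) le_rfl).trans
      (Finset.expect_le_expect fun M' _ => ind_mono fun h => ⟨hs, h⟩)
    · rw [hx1, hy1]
      exact (Real.exp_le_exp.2 (by linarith)).trans (term_step_bound hm hβ)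
    · rw [hx0, hy0]
      exact (Real.exp_le_exp.2 (by have := Real.exp_pos 2; linarith)).trans
        (clause_step_bound hm2)
  have hmean := expect_card_mul_card hℓ hm hn (le_max_left _ _) hq0.le hreach
    (sum_overlap_le hm)
  set C : ℝ := ((4 * m).choose (3 * m) : ℝ) with hC
  have hCpos : 0 < C := by
    have : 0 < (4 * m).choose (3 * m) := Nat.choose_pos (by omega)
    rw [hC]
    exact_mod_cast this
  have hprob := le_expect_ind_of_le_expect (K := C ^ 2) (c := q ^ 2 / 256) (by positivity)
    (by positivity) (fun ω : OmegaS ℓ (4 * m) B =>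
      (mul_le_mul (card_edgeSet_le _ _ _ _) (card_edgeSet_le _ _ _ _) (by positivity)
        hCpos.le).trans_eq (sq C).symm)
    (le_trans (mul_le_mul_of_nonneg_right (by linarith) (by positivity)) hmean)
  rw [← expect_ind]
  refine hprob.trans (Finset.expect_le_expect fun ω _ => ind_mono fun h => ?_)
  have hfar : ∀ g : (Fin (4 * m) → Bool) → Bool, Unate g →
      q ^ 2 / 512 ≤ relDist (sandwichFn ℓ hn ω) g := fun g hg =>
    hg.le_relDist (by positivity) (le_trans (le_of_eq (by ring)) h)
  exact ⟨hfar, fun g hg => hfar g hg.unate⟩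
end

section
/- Let n ≥ 4 be an integer divisible by 4, and let P ⊆ P' be two nonempty finite sets of points of {0,1}^n lying in the sandwich layers. Assume |A_{P',1}| ≥ 3n/4 − 100(log₂ n)|P'| and |A_{P,0}| ≥ n/4 − 100(log₂ n)|P|. Then |A_{P,1}| ≥ 3n/4 − 100(log₂ n) · min(|P|², |P'|). -/
open Finset

/-- `x` lies in the sandwich layers: `3n/4 ≤ |x| ≤ 3n/4 + 1`. -/
def SandwichLayers (n : ℕ) (x : Fin n → Bool) : Prop :=
  3 * n ≤ 4 * hwt x ∧ 4 * hwt x ≤ 3 * n + 4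

/-- `A_{S,b}`: the coordinates on which all points of `S` are equal to `b`. -/
def Aset {n : ℕ} (S : Finset (Fin n → Bool)) (b : Bool) : Finset (Fin n) :=
  univ.filter fun i => ∀ x ∈ S, x i = b

/-- The coordinates on which `x` vanishes complement its support. -/
lemma hwt_add_card_filter_false {n : ℕ} (x : Fin n → Bool) :
    hwt x + (univ.filter fun i => x i = false).card = n := by
  have h := card_filter_add_card_filter_not (s := (univ : Finset (Fin n))) (fun i => x i = true)
  simpa [hwt] using h

lemma Aset_anti {n : ℕ} {S T : Finset (Fin n → Bool)} (h : S ⊆ T) (b : Bool) :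
    Aset T b ⊆ Aset S b := by
  intro i hi
  simp only [Aset, mem_filter, mem_univ, true_and] at hi ⊢
  exact fun x hx => hi x (h hx)

lemma Aset_false_subset {n : ℕ} {S : Finset (Fin n → Bool)} {x : Fin n → Bool} (hx : x ∈ S) :
    Aset S false ⊆ univ.filter fun i => x i = false := by
  intro i hi
  simp only [Aset, mem_filter, mem_univ, true_and] at hi ⊢
  exact hi x hx

/-- Union bound: the coordinates outside `Aset S true` are those in `Aset S false` or in some
zero set of a point of `S` but outside `Aset S false`. -/
lemma card_le_card_Aset_add {n k : ℕ} {S : Finset (Fin n → Bool)}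
    (hS : ∀ x ∈ S, (univ.filter fun i => x i = false).card ≤ k) :
    n ≤ (Aset S true).card + ((Aset S false).card + S.card * (k - (Aset S false).card)) := by
  have hcover : (univ : Finset (Fin n)) ⊆ Aset S true ∪ (Aset S false ∪
      S.biUnion fun x => (univ.filter fun i => x i = false) \ Aset S false) := by
    intro i _
    by_cases h1 : i ∈ Aset S true
    · exact mem_union_left _ h1
    refine mem_union_right _ ?_
    by_cases h0 : i ∈ Aset S false
    · exact mem_union_left _ h0
    refine mem_union_right _ ?_
    simp only [Aset, mem_filter, mem_univ, true_and, not_forall] at h1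
    obtain ⟨x, hx, hxi⟩ := h1
    exact mem_biUnion.2 ⟨x, hx, mem_sdiff.2 ⟨by simpa using hxi, h0⟩⟩
  have hU : (S.biUnion fun x => (univ.filter fun i => x i = false) \ Aset S false).card
      ≤ S.card * (k - (Aset S false).card) := by
    refine card_biUnion_le_card_mul _ _ _ fun x hx => ?_
    rw [card_sdiff_of_subset (Aset_false_subset hx)]
    exact Nat.sub_le_sub_right (hS x hx) _
  have h := card_le_card hcover
  rw [card_univ, Fintype.card_fin] at h
  exact (h.trans (card_union_le _ _)).trans <| Nat.add_le_add_left
    ((card_union_le _ _).trans (Nat.add_le_add_left hU _)) _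

theorem stmt19 (n : ℕ) (hn : 4 ≤ n) (hdvd : 4 ∣ n)
    (P P' : Finset (Fin n → Bool)) (hPne : P.Nonempty) (hP'ne : P'.Nonempty)
    (hsub : P ⊆ P') (hmid : ∀ x ∈ P', SandwichLayers n x)
    (h1 : 3 * (n : ℝ) / 4 - 100 * Real.logb 2 n * P'.card ≤ ((Aset P' true).card : ℝ))
    (h0 : (n : ℝ) / 4 - 100 * Real.logb 2 n * P.card ≤ ((Aset P false).card : ℝ)) :
    3 * (n : ℝ) / 4 - 100 * Real.logb 2 n * min ((P.card : ℝ) ^ 2) (P'.card : ℝ)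
      ≤ ((Aset P true).card : ℝ) := by
  have hL : 0 ≤ Real.logb 2 n :=
    Real.logb_nonneg (by norm_num) (by exact_mod_cast (by omega : 1 ≤ n))
  rcases min_choice ((P.card : ℝ) ^ 2) (P'.card : ℝ) with h | h <;> rw [h]
  · obtain ⟨k, rfl⟩ := hdvd
    have hZ : ∀ x ∈ P, (univ.filter fun i => x i = false).card ≤ k := by
      intro x hx
      have hw := (hmid x (hsub hx)).1
      have hc := hwt_add_card_filter_false x
      omega
    obtain ⟨x, hx⟩ := hPne
    have hak : (Aset P false).card ≤ k := (card_le_card (Aset_false_subset hx)).trans (hZ x hx)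
    have hcard : ((4 * k : ℕ) : ℝ) ≤ (Aset P true).card +
        ((Aset P false).card + P.card * ((k : ℝ) - (Aset P false).card)) := by
      rw [← Nat.cast_sub hak]
      exact_mod_cast card_le_card_Aset_add hZ
    have hak' : ((Aset P false).card : ℝ) ≤ k := by exact_mod_cast hak
    have hp : (0 : ℝ) ≤ P.card := by positivity
    have hgap : (k : ℝ) - (Aset P false).card ≤ 100 * Real.logb 2 (4 * k : ℕ) * P.card := by
      push_cast at h0 ⊢
      linarith
    have hmul := mul_le_mul_of_nonneg_left hgap hp
    have hn4 : ((4 * k : ℕ) : ℝ) = 4 * k := by push_cast; ring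
    have hsq : (P.card : ℝ) * (100 * Real.logb 2 (4 * k : ℕ) * P.card)
        = 100 * Real.logb 2 (4 * k : ℕ) * (P.card : ℝ) ^ 2 := by ring
    rw [hsq] at hmul
    linarith
  · exact h1.trans (by exact_mod_cast card_le_card (Aset_anti hsub true))
end
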